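/- arXiv:1802.02718 — 3 statements merged into one kernel-verified Lean document; each statement's English description precedes it below -/
import Mathlib

section
/- There exist absolute constants C < ∞ and d ∈ ℕ such that for every finite field F_q the following holds: if X, Y ∈ F_q are independent random variables, then 1 − H̄(X + Y) ≤ C·q^d·(1 − H̄(X))·(1 − H̄(Y)). -/
open MeasureTheory ProbabilityTheory Real Finset

/-- The probability mass that the random variable `X` puts on the value `a`. -/
noncomputable def massOf {Ω : Type*} [MeasurableSpace Ω] (μ : Measure Ω)
    {S : Type*} (X : Ω → S) (a : S) : ℝ :=
  (μ (X ⁻¹' {a})).toReal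

/-- Shannon entropy (in bits) of a random variable with values in a finite type. -/
noncomputable def entropy {Ω : Type*} [MeasurableSpace Ω] (μ : Measure Ω)
    {S : Type*} [Fintype S] (X : Ω → S) : ℝ :=
  (∑ a : S, Real.negMulLog (massOf μ X a)) / Real.log 2

/-- Conditional Shannon entropy (in bits) `H(X | Y)`. -/
noncomputable def condEntropy {Ω : Type*} [MeasurableSpace Ω] (μ : Measure Ω)
    {S T : Type*} [Fintype S] [Fintype T] (X : Ω → S) (Y : Ω → T) : ℝ :=
  ∑ b : T, massOf μ Y b * entropy (μ[|Y ⁻¹' {b}]) X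

/-- Normalized (`q`-ary) entropy `H̄(X) = H(X) / log₂ q`. -/
noncomputable def nEntropy {Ω : Type*} [MeasurableSpace Ω] (μ : Measure Ω)
    {S : Type*} [Fintype S] (X : Ω → S) : ℝ :=
  entropy μ X / Real.logb 2 (Fintype.card S)

/-- Normalized conditional entropy `H̄(X|Y) = H(X|Y) / log₂ q`. -/
noncomputable def nCondEntropy {Ω : Type*} [MeasurableSpace Ω] (μ : Measure Ω)
    {S T : Type*} [Fintype S] [Fintype T] (X : Ω → S) (Y : Ω → T) : ℝ :=
  condEntropy μ X Y / Real.logb 2 (Fintype.card S)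

/-- The relative entropy (in nats) of a mass function with respect to the uniform distribution. -/
noncomputable def uniformGap {S : Type*} [Fintype S] (p : S → ℝ) : ℝ :=
  Real.log (Fintype.card S) - ∑ a, Real.negMulLog (p a)

lemma mul_log_sub_negMulLog_le {n x : ℝ} (hn : 0 < n) (hx : 0 ≤ x) :
    x * Real.log n - Real.negMulLog x ≤ x * (n * x - 1) := by
  rcases hx.eq_or_lt with rfl | hx
  · simp
  have h := Real.log_le_sub_one_of_pos (mul_pos hn hx)
  rw [Real.log_mul hn.ne' hx.ne'] at h
  have := mul_le_mul_of_nonneg_left h hx.le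
  rw [Real.negMulLog]
  linarith

lemma sq_sub_inv_le_mul_log_sub_negMulLog {n x : ℝ} (hn : 1 ≤ n) (hx : 0 ≤ x) (hx1 : x ≤ 1) :
    (x - 1 / n) ^ 2 / 4 ≤ x * Real.log n - Real.negMulLog x - x + 1 / n := by
  have hn0 : 0 < n := by linarith
  obtain ⟨t, ht0, ht⟩ : ∃ t : ℝ, 0 ≤ t ∧ n * x = t ^ 2 :=
    ⟨√(n * x), Real.sqrt_nonneg _, (Real.sq_sqrt (by positivity)).symm⟩
  have hxt : x = t ^ 2 / n := by rw [← ht]; field_simp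
  have htn : t ^ 2 ≤ n := by rw [← ht]; nlinarith
  have hlog : 2 * (t ^ 2 - t) / n ≤ x * Real.log n - Real.negMulLog x := by
    rcases ht0.eq_or_lt with rfl | htpos
    · simp [hxt]
    have hxpos : 0 < x := by rw [hxt]; positivity
    have h1 := Real.one_sub_inv_le_log_of_pos htpos
    have h2 : Real.log n + Real.log x = 2 * Real.log t := by
      rw [← Real.log_mul hn0.ne' hxpos.ne', ht, Real.log_pow]; norm_num
    have h3 : x * Real.log n - Real.negMulLog x = x * (2 * Real.log t) := by
      rw [← h2, Real.negMulLog]; ring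
    have h4 : 2 * (t ^ 2 - t) / n = x * (2 * (1 - t⁻¹)) := by
      rw [hxt]; field_simp
    rw [h3, h4]
    gcongr
  have hquad : (x - 1 / n) ^ 2 / 4 ≤ (t - 1) ^ 2 / n := by
    have h1 : (x - 1 / n) ^ 2 / 4 = (t - 1) ^ 2 / n * ((t + 1) ^ 2 / (4 * n)) := by
      rw [hxt]; field_simp; ring
    rw [h1]
    refine mul_le_of_le_one_right (by positivity) ?_
    rw [div_le_one (by positivity)]
    nlinarith [sq_nonneg (t - 1)]
  have hsplit : (t - 1) ^ 2 / n = 2 * (t ^ 2 - t) / n - x + 1 / n := by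
    rw [hxt]; field_simp; ring
  linarith

lemma uniformGap_eq_sum {S : Type*} [Fintype S] {p : S → ℝ} (hp : ∑ a, p a = 1) :
    uniformGap p = ∑ a, (p a * Real.log (Fintype.card S) - Real.negMulLog (p a)) := by
  rw [Finset.sum_sub_distrib, ← Finset.sum_mul, hp, one_mul, uniformGap]

lemma uniformGap_le {S : Type*} [Fintype S] [Nonempty S] {p : S → ℝ}
    (h0 : ∀ a, 0 ≤ p a) (hp : ∑ a, p a = 1) :
    uniformGap p ≤ Fintype.card S * ∑ a, (p a - 1 / Fintype.card S) ^ 2 := by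
  have hn : (0 : ℝ) < Fintype.card S := by exact_mod_cast Fintype.card_pos
  rw [uniformGap_eq_sum hp]
  refine (Finset.sum_le_sum fun a _ ↦ mul_log_sub_negMulLog_le hn (h0 a)).trans_eq ?_
  have h (a : S) : p a * (Fintype.card S * p a - 1) =
      Fintype.card S * (p a - 1 / Fintype.card S) ^ 2 + (p a - 1 / Fintype.card S) := by
    field_simp; ring
  simp_rw [h, Finset.sum_add_distrib, ← Finset.mul_sum, Finset.sum_sub_distrib, hp]
  simp [hn.ne']

lemma sum_sq_sub_le_uniformGap {S : Type*} [Fintype S] [Nonempty S] {p : S → ℝ}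
    (h0 : ∀ a, 0 ≤ p a) (hp : ∑ a, p a = 1) :
    ∑ a, (p a - 1 / Fintype.card S) ^ 2 ≤ 4 * uniformGap p := by
  have hn : (1 : ℝ) ≤ Fintype.card S := by exact_mod_cast Fintype.card_pos
  have h1 (a : S) : p a ≤ 1 := by
    rw [← hp]; exact Finset.single_le_sum (fun i _ ↦ h0 i) (Finset.mem_univ a)
  have h := Finset.sum_le_sum fun a (_ : a ∈ Finset.univ) ↦
    sq_sub_inv_le_mul_log_sub_negMulLog hn (h0 a) (h1 a)
  rw [Finset.sum_add_distrib, Finset.sum_sub_distrib _ p, ← uniformGap_eq_sum hp, hp,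
    ← Finset.sum_div] at h
  have hc : ∑ _a : S, 1 / (Fintype.card S : ℝ) = 1 := by
    simp
  linarith

lemma uniformGap_convolution_le {G : Type*} [AddCommGroup G] [Fintype G] {p r s : G → ℝ}
    (hp0 : ∀ a, 0 ≤ p a) (hp : ∑ a, p a = 1) (hr0 : ∀ a, 0 ≤ r a) (hr : ∑ a, r a = 1)
    (hs : ∀ a, s a = ∑ b, p (a - b) * r b) :
    uniformGap s ≤ 16 * (Fintype.card G : ℝ) ^ 2 * uniformGap p * uniformGap r := by
  have hn : (0 : ℝ) < Fintype.card G := by exact_mod_cast Fintype.card_pos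
  have hshift (a : G) (f : G → ℝ) : ∑ b, f (a - b) = ∑ b, f b :=
    (Equiv.subLeft a).sum_comp f
  have hs0 (a : G) : 0 ≤ s a := by
    rw [hs]; exact Finset.sum_nonneg fun b _ ↦ mul_nonneg (hp0 _) (hr0 _)
  have hs1 : ∑ a, s a = 1 := by
    simp_rw [hs]
    rw [Finset.sum_comm]
    simp_rw [← Finset.sum_mul]
    have (b : G) : ∑ a, p (a - b) = 1 := by rw [← hp]; exact (Equiv.subRight b).sum_comp p
    simp [this, hr]
  set n : ℝ := (Fintype.card G : ℝ) with hn_def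
  have hdev (a : G) : s a - 1 / n = ∑ b, (p (a - b) - 1 / n) * (r b - 1 / n) := by
    simp_rw [sub_mul, mul_sub, Finset.sum_sub_distrib, ← Finset.sum_mul, ← Finset.mul_sum,
      hshift a p, hp, hr, hs]
    simp [← hn_def, hn.ne']
  have hcs (a : G) : (s a - 1 / n) ^ 2 ≤ (∑ b, (p b - 1 / n) ^ 2) * ∑ b, (r b - 1 / n) ^ 2 := by
    rw [hdev, ← hshift a fun b ↦ (p b - 1 / n) ^ 2]
    exact Finset.sum_mul_sq_le_sq_mul_sq _ _ _
  have hP := sum_sq_sub_le_uniformGap hp0 hp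
  have hR := sum_sq_sub_le_uniformGap hr0 hr
  rw [← hn_def] at hP hR
  have hP0 : 0 ≤ ∑ b, (p b - 1 / n) ^ 2 := by positivity
  have hR0 : 0 ≤ ∑ b, (r b - 1 / n) ^ 2 := by positivity
  calc uniformGap s ≤ n * ∑ a, (s a - 1 / n) ^ 2 := uniformGap_le hs0 hs1
    _ ≤ n * ∑ _a : G, (∑ b, (p b - 1 / n) ^ 2) * ∑ b, (r b - 1 / n) ^ 2 := by
      gcongr with a; exact hcs a
    _ = n ^ 2 * ((∑ b, (p b - 1 / n) ^ 2) * ∑ b, (r b - 1 / n) ^ 2) := by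
      rw [Finset.sum_const, Finset.card_univ, nsmul_eq_mul]; ring
    _ ≤ n ^ 2 * ((4 * uniformGap p) * (4 * uniformGap r)) := by
      gcongr; linarith
    _ = _ := by ring

lemma sum_massOf_eq_one {Ω : Type*} [MeasurableSpace Ω] {μ : Measure Ω} [IsProbabilityMeasure μ]
    {S : Type*} [Fintype S] [MeasurableSpace S] [MeasurableSingletonClass S]
    {X : Ω → S} (hX : Measurable X) : ∑ a, massOf μ X a = 1 := by
  have h := sum_measureReal_preimage_singleton (μ := μ) (f := X) Finset.univ
    fun a _ ↦ hX (measurableSet_singleton a)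
  simpa [massOf, Measure.real] using h

lemma massOf_add {Ω : Type*} [MeasurableSpace Ω] {μ : Measure Ω} [IsProbabilityMeasure μ]
    {G : Type*} [AddGroup G] [Fintype G] [MeasurableSpace G]
    [MeasurableSingletonClass G] {X Y : Ω → G} (hX : Measurable X) (hY : Measurable Y)
    (h : IndepFun X Y μ) (a : G) :
    massOf μ (fun ω ↦ X ω + Y ω) a = ∑ b, massOf μ X (a - b) * massOf μ Y b := by
  have hpre : (fun ω ↦ X ω + Y ω) ⁻¹' {a} =
      ⋃ b ∈ (Finset.univ : Finset G), X ⁻¹' {a - b} ∩ Y ⁻¹' {b} := by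
    ext ω
    simp [eq_sub_iff_add_eq]
  have hmeas (c : G) := measurableSet_singleton c
  simp_rw [massOf, hpre]
  rw [measure_biUnion_finset, ENNReal.toReal_sum fun _ _ ↦ measure_ne_top _ _]
  · refine Finset.sum_congr rfl fun b _ ↦ ?_
    rw [h.measure_inter_preimage_eq_mul _ _ (hmeas _) (hmeas _), ENNReal.toReal_mul]
  · intro b _ c _ hbc
    refine Set.disjoint_left.2 fun ω hb hc ↦ hbc ?_
    exact (Set.mem_singleton_iff.1 hb.2).symm.trans hc.2
  · exact fun b _ ↦ (hX (hmeas _)).inter (hY (hmeas _))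

lemma one_sub_nEntropy {Ω : Type*} [MeasurableSpace Ω] {μ : Measure Ω}
    {S : Type*} [Fintype S] [Nontrivial S] (X : Ω → S) :
    1 - nEntropy μ X = uniformGap (massOf μ X) / Real.log (Fintype.card S) := by
  have hn : (1 : ℝ) < Fintype.card S := by exact_mod_cast Fintype.one_lt_card
  have hlog := (Real.log_pos hn).ne'
  have h2 : Real.log 2 ≠ 0 := (Real.log_pos one_lt_two).ne'
  rw [nEntropy, entropy, uniformGap, Real.logb]
  field_simp

/-- **Lemma (suction at the upper end, unconditional version).** There are absolute constants
`C < ∞` and `d ∈ ℕ` such that for every finite field `F_q` and independent `X, Y ∈ F_q`,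
`1 − H̄(X+Y) ≤ C · q^d · (1 − H̄(X)) · (1 − H̄(Y))`. -/
theorem entropy_gap_of_sum_le :
    ∃ (C : ℝ) (d : ℕ), 0 < C ∧
      ∀ (F : Type) [Field F] [Fintype F] [MeasurableSpace F] [MeasurableSingletonClass F]
        (Ω : Type) [MeasurableSpace Ω] (μ : Measure Ω) [IsProbabilityMeasure μ]
        (X Y : Ω → F), Measurable X → Measurable Y → IndepFun X Y μ →
        1 - nEntropy μ (fun ω => X ω + Y ω) ≤
          C * (Fintype.card F : ℝ) ^ d * (1 - nEntropy μ X) * (1 - nEntropy μ Y) := by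
  refine ⟨16, 3, by norm_num, ?_⟩
  intro F _ _ _ _ Ω _ μ _ X Y hX hY hXY
  have hn : (1 : ℝ) < Fintype.card F := by exact_mod_cast Fintype.one_lt_card
  have hL := Real.log_pos hn
  have hLn : Real.log (Fintype.card F) ≤ Fintype.card F := Real.log_le_self (by linarith)
  have hX0 (a : F) : 0 ≤ massOf μ X a := ENNReal.toReal_nonneg
  have hY0 (a : F) : 0 ≤ massOf μ Y a := ENNReal.toReal_nonneg
  have hX1 := sum_massOf_eq_one (μ := μ) hX
  have hY1 := sum_massOf_eq_one (μ := μ) hY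
  have hconv := uniformGap_convolution_le hX0 hX1 hY0 hY1 (massOf_add hX hY hXY)
  have hgX : 0 ≤ uniformGap (massOf μ X) := by
    have := (Finset.sum_nonneg fun a _ ↦ sq_nonneg _).trans (sum_sq_sub_le_uniformGap hX0 hX1)
    linarith
  have hgY : 0 ≤ uniformGap (massOf μ Y) := by
    have := (Finset.sum_nonneg fun a _ ↦ sq_nonneg _).trans (sum_sq_sub_le_uniformGap hY0 hY1)
    linarith
  simp only [one_sub_nEntropy]
  set n : ℝ := (Fintype.card F : ℝ)
  set L := Real.log n
  set gX := uniformGap (massOf μ X)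
  set gY := uniformGap (massOf μ Y)
  calc _ ≤ 16 * n ^ 2 * gX * gY / L := by gcongr
    _ = 16 * (n ^ 2 * L) * (gX / L) * (gY / L) := by field_simp
    _ ≤ 16 * (n ^ 2 * n) * (gX / L) * (gY / L) := by gcongr
    _ = 16 * n ^ 3 * (gX / L) * (gY / L) := by ring
end

section
/- For every finite field F_q and every γ ∈ (0,1) there exists α₁ > 0 such that the following holds: if X is a random variable over F_q whose most likely value is 0, and H̄(X) ≤ α₁, then H̄(X) ≥ H(δ̄(X))/log₂ q ≥ (1 − γ)·H̄(X), where δ̄(X) := 1{X ≠ 0} is the indicator that X is nonzero. -/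
open MeasureTheory ProbabilityTheory Real Finset

/-- A probability vector whose largest entry is `p i` has entropy (in nats) at least `1 - p i`. -/
theorem one_sub_le_sum_negMulLog {ι : Type*} [Fintype ι] {p : ι → ℝ} (hp : ∀ a, 0 ≤ p a)
    (hsum : ∑ a, p a = 1) {i : ι} (hi : ∀ a, p a ≤ p i) :
    1 - p i ≤ ∑ a, negMulLog (p a) := by
  have key : ∀ a, p a * (1 - p i) ≤ negMulLog (p a) := by
    intro a
    rcases (hp a).eq_or_lt with h | h
    · simp [← h]
    · have h1 : log (p a) ≤ p i - 1 :=
        (log_le_sub_one_of_pos h).trans (by linarith [hi a])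
      have h2 := mul_le_mul_of_nonneg_left h1 h.le
      simp only [negMulLog]
      linarith
  calc 1 - p i = ∑ a, p a * (1 - p i) := by rw [← Finset.sum_mul, hsum, one_mul]
    _ ≤ _ := Finset.sum_le_sum fun a _ => key a

/-- Subadditivity of `negMulLog` on nonnegative reals. -/
theorem negMulLog_sum_le {ι : Type*} {s : Finset ι} {p : ι → ℝ} (hp : ∀ a ∈ s, 0 ≤ p a) :
    negMulLog (∑ a ∈ s, p a) ≤ ∑ a ∈ s, negMulLog (p a) := by
  set t := ∑ a ∈ s, p a with ht
  calc negMulLog t = ∑ a ∈ s, p a * (-log t) := by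
        rw [← Finset.sum_mul, ← ht, negMulLog]; ring
    _ ≤ _ := Finset.sum_le_sum fun a ha => by
        rcases (hp a ha).eq_or_lt with h | h
        · simp [← h]
        · have h1 : log (p a) ≤ log t := log_le_log h (Finset.single_le_sum hp ha)
          have h2 := mul_le_mul_of_nonneg_left h1 h.le
          simp only [negMulLog]
          linarith

/-- Splitting a mass into at most `c` parts increases `negMulLog` by at most `log c` times
that mass. -/
theorem sum_negMulLog_le {ι : Type*} {s : Finset ι} {p : ι → ℝ} (hp : ∀ a ∈ s, 0 ≤ p a)
    {c : ℝ} (hc : 0 < c) (hs : (s.card : ℝ) ≤ c) :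
    ∑ a ∈ s, negMulLog (p a) ≤ negMulLog (∑ a ∈ s, p a) + (∑ a ∈ s, p a) * log c := by
  set t := ∑ a ∈ s, p a with ht
  have ht0 : 0 ≤ t := Finset.sum_nonneg hp
  have key : ∀ a ∈ s, negMulLog (p a) ≤ p a * (log c - log t - 1) + t / c := by
    intro a ha
    rcases (hp a ha).eq_or_lt with h | h
    · simp only [← h, negMulLog_zero, zero_mul, zero_add]
      positivity
    · have htp : 0 < t := h.trans_le (Finset.single_le_sum hp ha)
      have h1 := log_le_sub_one_of_pos (show 0 < t / (c * p a) by positivity)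
      rw [log_div htp.ne' (by positivity), log_mul hc.ne' h.ne'] at h1
      have h2 := mul_le_mul_of_nonneg_left h1 h.le
      have h3 : p a * (t / (c * p a) - 1) = t / c - p a := by field_simp
      simp only [negMulLog]
      linarith
  have h := Finset.sum_le_sum key
  rw [Finset.sum_add_distrib, ← Finset.sum_mul, ← ht, Finset.sum_const, nsmul_eq_mul] at h
  have h4 : (s.card : ℝ) * (t / c) ≤ t :=
    calc (s.card : ℝ) * (t / c) ≤ c * (t / c) := by gcongr
      _ = t := by field_simp
  simp only [negMulLog] at h ⊢
  linarith

theorem sum_massOf {Ω S : Type*} [MeasurableSpace Ω] (μ : Measure Ω) [IsProbabilityMeasure μ]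
    [Fintype S] [MeasurableSpace S] [MeasurableSingletonClass S] {X : Ω → S}
    (hX : Measurable X) : ∑ a, massOf μ X a = 1 := by
  have h := sum_measureReal_preimage_singleton (μ := μ) (f := X) Finset.univ
    (fun a _ => hX (measurableSet_singleton a))
  simpa [massOf, Measure.real] using h

theorem entropy_indicator {Ω S : Type*} [MeasurableSpace Ω] (μ : Measure Ω)
    [IsProbabilityMeasure μ] [DecidableEq S] [MeasurableSpace S] [MeasurableSingletonClass S]
    {X : Ω → S} (hX : Measurable X) (i : S) :
    entropy μ (fun ω => if X ω = i then (0 : Fin 2) else 1) =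
      (negMulLog (massOf μ X i) + negMulLog (1 - massOf μ X i)) / log 2 := by
  have h0 : (fun ω => if X ω = i then (0 : Fin 2) else 1) ⁻¹' {0} = X ⁻¹' {i} := by
    ext ω; by_cases h : X ω = i <;> simp [h]
  have h1 : (fun ω => if X ω = i then (0 : Fin 2) else 1) ⁻¹' {1} = (X ⁻¹' {i})ᶜ := by
    ext ω; by_cases h : X ω = i <;> simp [h]
  have h2 := probReal_compl_eq_one_sub (μ := μ) (hX (measurableSet_singleton i))
  simp only [Measure.real] at h2
  simp only [entropy, Fin.sum_univ_two, massOf, h0, h1, h2]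

/-- **Lemma.** For every finite field `F_q` and `γ ∈ (0,1)` there is `α₁ > 0` such that: if
`X` is a random variable over `F_q` whose most likely value is `0` and `H̄(X) ≤ α₁`, then
`H̄(X) ≥ H(δ̄(X))/log₂ q ≥ (1 − γ) · H̄(X)`, where `δ̄(X) = 1{X ≠ 0}`. -/
theorem entropy_delta_comparable
    (F : Type*) [Field F] [Fintype F] [DecidableEq F]
    [MeasurableSpace F] [MeasurableSingletonClass F]
    (γ : ℝ) (hγ0 : 0 < γ) (hγ1 : γ < 1) :
    ∃ α₁ : ℝ, 0 < α₁ ∧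
      ∀ (Ω : Type) [MeasurableSpace Ω] (μ : Measure Ω) [IsProbabilityMeasure μ]
        (X : Ω → F), Measurable X →
        (∀ a : F, massOf μ X a ≤ massOf μ X 0) →
        nEntropy μ X ≤ α₁ →
        entropy μ (fun ω => if X ω = 0 then (0 : Fin 2) else 1) /
            Real.logb 2 (Fintype.card F) ≤ nEntropy μ X ∧
        (1 - γ) * nEntropy μ X ≤
          entropy μ (fun ω => if X ω = 0 then (0 : Fin 2) else 1) /
            Real.logb 2 (Fintype.card F) := by
  set L := log (Fintype.card F) with hL
  have hcard : (1 : ℝ) < Fintype.card F := by exact_mod_cast Fintype.one_lt_card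
  have hLpos : 0 < L := log_pos hcard
  have hlog2 : 0 < log 2 := log_pos one_lt_two
  have hnorm : ∀ x : ℝ, x / log 2 / logb 2 (Fintype.card F) = x / L := by
    intro x
    rw [logb, div_div_div_cancel_right₀ hlog2.ne']
  refine ⟨exp (-(L / γ)) / L, by positivity, fun Ω _ μ _ X hX hmax hle => ?_⟩
  simp only [nEntropy, entropy_indicator μ hX 0] at hle ⊢
  simp only [entropy, hnorm] at hle ⊢
  have hp : ∀ a, 0 ≤ massOf μ X a := fun a => ENNReal.toReal_nonneg
  have hsum := sum_massOf μ hX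
  have hsmall := (one_sub_le_sum_negMulLog hp hsum hmax).trans
    ((div_le_div_iff_of_pos_right hLpos).1 hle)
  have hrest : ∑ a ∈ Finset.univ.erase (0 : F), massOf μ X a = 1 - massOf μ X 0 := by
    rw [← hsum, ← Finset.add_sum_erase _ _ (Finset.mem_univ (0 : F))]; ring
  have hlow := negMulLog_sum_le (s := Finset.univ.erase (0 : F)) fun a _ => hp a
  have hup := sum_negMulLog_le (s := Finset.univ.erase (0 : F)) (fun a _ => hp a)
    (zero_lt_one.trans hcard) (by exact_mod_cast Finset.card_le_univ _)
  have ht0 : 0 ≤ 1 - massOf μ X 0 := hrest ▸ Finset.sum_nonneg fun a _ => hp a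
  rw [hrest] at hlow hup
  rw [← Finset.add_sum_erase _ (fun a => negMulLog (massOf μ X a)) (Finset.mem_univ (0 : F)),
    ← mul_div_assoc]
  refine ⟨by gcongr, ?_⟩
  gcongr
  have hη0 : 0 ≤ negMulLog (massOf μ X 0) := negMulLog_nonneg (hp 0) (by linarith)
  have hη1 : (1 - massOf μ X 0) * L ≤ γ * negMulLog (1 - massOf μ X 0) := by
    rcases ht0.eq_or_lt with h | h
    · simp [← h]
    · have h1 : log (1 - massOf μ X 0) ≤ -(L / γ) := (log_le_iff_le_exp h).2 hsmall
      have h2 : L ≤ γ * -log (1 - massOf μ X 0) := by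
        rw [← div_le_iff₀' hγ0]; linarith
      have h3 := mul_le_mul_of_nonneg_left h2 h.le
      simp only [negMulLog]
      linarith
  have h5 := mul_le_mul_of_nonneg_left hup (sub_nonneg.2 hγ1.le)
  have h6 := mul_nonneg hγ0.le hη0
  have h7 := mul_nonneg hγ0.le (mul_nonneg ht0 hLpos.le)
  linarith
end

section
/- Let (U, W) be jointly distributed random variables where U ∈ F_q^k, and let M ∈ F_q^{k×k} be a mixing matrix. Then there exist indices j, ℓ, s ∈ [k] with ℓ ≠ s and a nonzero α ∈ F_q such that H̄((U·M)_j | (U·M)_{<j}, W) ≤ H̄(U_ℓ | U_ℓ + α·U_s, W), where (U·M)_{<j} denotes the coordinates of U·M with index less than j. -/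
open MeasureTheory ProbabilityTheory Real Finset

/-- A matrix is *mixing* if it is invertible and no row permutation of it is upper
triangular: for every permutation `σ` of `[k]` there are `i, j` with `j < σ(i)` and
`M i j ≠ 0`. -/
def Mixing {k : ℕ} {F : Type*} [CommRing F] (M : Matrix (Fin k) (Fin k) F) : Prop :=
  IsUnit M ∧ ∀ σ : Equiv.Perm (Fin k), ∃ i j : Fin k, (j : ℕ) < (σ i : ℕ) ∧ M i j ≠ 0

section EntropyLemmas

variable {Ω : Type*} [MeasurableSpace Ω] (μ : Measure Ω) {S R Q : Type*}

/-- The conditional entropy does not change under a bijection depending on the condition. -/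
lemma condEntropy_eq_of_equiv [Fintype S] [Fintype R] {X X' : Ω → S} {Y : Ω → R}
    (hY : ∀ b, MeasurableSet (Y ⁻¹' {b})) (e : R → S ≃ S)
    (he : ∀ ω, X' ω = e (Y ω) (X ω)) :
    condEntropy μ X' Y = condEntropy μ X Y := by
  unfold condEntropy entropy
  refine Finset.sum_congr rfl fun b _ => ?_
  congr 2
  refine (Fintype.sum_equiv (e b) _ _ fun a => ?_).symm
  congr 1
  unfold massOf
  rw [cond_apply (hY b), cond_apply (hY b)]
  congr 3
  ext ω
  simp only [Set.mem_inter_iff, Set.mem_preimage, Set.mem_singleton_iff]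
  refine and_congr_right fun h => ?_
  rw [he ω, h, (e b).injective.eq_iff]

lemma massOf_nonneg (X : Ω → S) (a : S) : 0 ≤ massOf μ X a := ENNReal.toReal_nonneg

lemma massOf_comp [IsFiniteMeasure μ] [Fintype R] [DecidableEq Q] {Y : Ω → R}
    (hY : ∀ b, MeasurableSet (Y ⁻¹' {b})) (f : R → Q) (c : Q) :
    massOf μ (fun ω => f (Y ω)) c = ∑ b with f b = c, massOf μ Y b := by
  unfold massOf
  rw [← ENNReal.toReal_sum (fun _ _ => measure_ne_top _ _),
    sum_measure_preimage_singleton _ fun b _ => hY b]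
  congr 2
  ext ω
  simp

lemma mul_massOf_cond [IsFiniteMeasure μ] {X : Ω → S} {Y : Ω → R}
    (hY : ∀ b, MeasurableSet (Y ⁻¹' {b})) (a : S) (b : R) :
    massOf μ Y b * massOf (μ[|Y ⁻¹' {b}]) X a = massOf (μ.restrict (X ⁻¹' {a})) Y b := by
  unfold massOf
  rw [cond_apply (hY b), Measure.restrict_apply (hY b), ← ENNReal.toReal_mul]
  by_cases h : μ (Y ⁻¹' {b}) = 0
  · rw [h, zero_mul, measure_mono_null Set.inter_subset_left h]
  · rw [← mul_assoc, ENNReal.mul_inv_cancel h (measure_ne_top _ _), one_mul]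

/-- Conditioning on a function of `Y` gives at least as much entropy as conditioning on `Y`. -/
lemma condEntropy_le_comp [IsFiniteMeasure μ] [Fintype S] [Fintype R] [Fintype Q]
    {X : Ω → S} {Y : Ω → R}
    (hY : ∀ b, MeasurableSet (Y ⁻¹' {b})) (f : R → Q) :
    condEntropy μ X Y ≤ condEntropy μ X (fun ω => f (Y ω)) := by
  classical
  have hfY : ∀ c, MeasurableSet ((fun ω => f (Y ω)) ⁻¹' {c}) := fun c => by
    have : (fun ω => f (Y ω)) ⁻¹' {c} = ⋃ b ∈ f ⁻¹' {c}, Y ⁻¹' {b} := by ext; simp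
    rw [this]
    exact MeasurableSet.biUnion (Set.to_countable _) fun b _ => hY b
  unfold condEntropy entropy
  rw [← Finset.sum_fiberwise (s := Finset.univ) (g := f)]
  refine Finset.sum_le_sum fun c _ => ?_
  simp only [← mul_div_assoc]
  rw [← Finset.sum_div]
  refine div_le_div_of_nonneg_right ?_ (Real.log_nonneg one_le_two)
  simp only [Finset.mul_sum]
  rw [Finset.sum_comm]
  refine Finset.sum_le_sum fun a _ => ?_
  have hsum := massOf_comp μ hY f c
  rcases (massOf_nonneg μ (fun ω => f (Y ω)) c).eq_or_lt with h0 | hpos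
  · rw [← h0, zero_mul]
    rw [← h0, eq_comm, Finset.sum_eq_zero_iff_of_nonneg fun b _ => massOf_nonneg μ Y b] at hsum
    exact (Finset.sum_eq_zero fun b hb => by rw [hsum b hb, zero_mul]).le
  · have hJ := Real.concaveOn_negMulLog.le_map_centerMass (t := {b | f b = c})
      (w := fun b => massOf μ Y b) (p := fun b => massOf (μ[|Y ⁻¹' {b}]) X a)
      (fun b _ => massOf_nonneg μ Y b) (hsum ▸ hpos) (fun b _ => massOf_nonneg _ _ _)
    simp only [Finset.centerMass, smul_eq_mul, Function.comp_apply, ← hsum,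
      mul_massOf_cond μ hY] at hJ
    rw [← massOf_comp _ hY f c, ← mul_massOf_cond μ hfY, inv_mul_cancel_left₀ hpos.ne',
      inv_mul_le_iff₀ hpos] at hJ
    exact hJ

end EntropyLemmas

lemma exists_last_ne_zero {k : ℕ} {F : Type*} [Zero F] {v : Fin k → F} (hv : v ≠ 0) :
    ∃ j, v j ≠ 0 ∧ ∀ t, j < t → v t = 0 := by
  classical
  obtain ⟨i, hi⟩ := Function.ne_iff.mp hv
  obtain ⟨j, hj, hmax⟩ := Finset.exists_max_image {j | v j ≠ 0} id ⟨i, by simpa using hi⟩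
  refine ⟨j, by simpa using hj, fun t ht => ?_⟩
  by_contra h
  exact absurd (hmax t (by simpa using h)) ht.not_ge

/-- Two columns of the inverse of a mixing matrix have their last nonzero entry in the
same row. -/
lemma Mixing.exists_inv_columns {k : ℕ} {F : Type*} [Field F] {M : Matrix (Fin k) (Fin k) F}
    (hM : Mixing M) :
    ∃ j l s : Fin k, l ≠ s ∧ M⁻¹ j l ≠ 0 ∧ M⁻¹ j s ≠ 0 ∧
      (∀ t, j < t → M⁻¹ t l = 0) ∧ ∀ t, j < t → M⁻¹ t s = 0 := by
  obtain ⟨hu, hσ⟩ := hM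
  have hdet : IsUnit M.det := (Matrix.isUnit_iff_isUnit_det M).mp hu
  have hcol : ∀ i, (fun t => M⁻¹ t i) ≠ 0 := fun i h => by
    have h1 := congrFun (congrFun (Matrix.mul_nonsing_inv M hdet) i) i
    simp [Matrix.mul_apply, fun t => congrFun h t] at h1
  choose p hp hp' using fun i => exists_last_ne_zero (hcol i)
  by_cases hinj : Function.Injective p
  · exfalso
    let σ : Equiv.Perm (Fin k) := Equiv.ofBijective p (Finite.injective_iff_bijective.mp hinj)
    obtain ⟨i, j, hij, hne⟩ := hσ σ
    have hB : (M⁻¹.submatrix (Equiv.refl _) σ.symm).BlockTriangular id := fun t u hut => by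
      refine hp' (σ.symm u) t ?_
      have : p (σ.symm u) = u := σ.apply_symm_apply u
      rwa [this]
    have : Invertible (M⁻¹.submatrix (Equiv.refl _) σ.symm) := by
      refine IsUnit.invertible ?_
      rw [Matrix.isUnit_submatrix_equiv, Matrix.isUnit_nonsing_inv_iff]
      exact hu
    have hB' := Matrix.blockTriangular_inv_of_blockTriangular hB
    rw [Matrix.inv_submatrix_equiv, Matrix.nonsing_inv_nonsing_inv _ hdet] at hB'
    have := hB' (i := σ i) (j := j) hij
    simp at this
    exact hne this
  · simp only [Function.Injective, not_forall] at hinj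
    obtain ⟨l, s, hls, hne⟩ := hinj
    exact ⟨p l, l, s, hne, hp l, hls ▸ hp s, hp' l, hls ▸ hp' s⟩

/-- A linear form whose coefficients vanish past `j` splits into its part below `j` and
its value at `j`. -/
lemma sum_eq_sum_lt_add {k : ℕ} {F : Type*} [CommRing F] (j : Fin k) (x c : Fin k → F)
    (hc : ∀ t, j < t → c t = 0) :
    ∑ t, x t * c t =
      ∑ i : Fin (j : ℕ), x (Fin.castLE j.isLt.le i) * c (Fin.castLE j.isLt.le i) + x j * c j := by
  obtain ⟨j, hj⟩ := j
  obtain ⟨m, rfl⟩ := Nat.exists_eq_add_of_le (Nat.succ_le_of_lt hj)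
  rw [Fin.sum_univ_add, Fin.sum_univ_castSucc, Finset.sum_eq_zero (s := Finset.univ)
    (f := fun i : Fin m => _), add_zero]
  · rfl
  · intro i _
    rw [hc _ (by simp [Fin.lt_def]; omega), mul_zero]

/-- **Lemma (reduction for suction at the lower end).** If `(U, W)` are jointly distributed
with `U ∈ F_q^k` and `M` is mixing, then there are indices `j, ℓ, s` with `ℓ ≠ s` and a
nonzero `α ∈ F_q` such that `H̄((U·M)_j | (U·M)_{<j}, W) ≤ H̄(U_ℓ | U_ℓ + α·U_s, W)`. -/
theorem reduction_suction_lower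
    {Ω : Type*} [MeasurableSpace Ω] (μ : Measure Ω) [IsProbabilityMeasure μ]
    {F : Type*} [Field F] [Fintype F] [MeasurableSpace F] [MeasurableSingletonClass F]
    {k : ℕ} {T : Type*} [Fintype T] [MeasurableSpace T] [MeasurableSingletonClass T]
    (U : Ω → Fin k → F) (W : Ω → T) (hU : Measurable U) (hW : Measurable W)
    (M : Matrix (Fin k) (Fin k) F) (hM : Mixing M) :
    ∃ (j l s : Fin k) (α : F), l ≠ s ∧ α ≠ 0 ∧
      nCondEntropy μ (fun ω => Matrix.vecMul (U ω) M j)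
          (fun ω =>
            ((fun i : Fin (j : ℕ) => Matrix.vecMul (U ω) M (Fin.castLE j.isLt.le i)),
              W ω)) ≤
        nCondEntropy μ (fun ω => U ω l)
          (fun ω => (U ω l + α * U ω s, W ω)) := by
  obtain ⟨j, l, s, hls, hl, hs, hl', hs'⟩ := hM.exists_inv_columns
  set N := M⁻¹ with hN
  have hU' : ∀ ω i, U ω i = ∑ t, Matrix.vecMul (U ω) M t * N t i := fun ω i => by
    have : Matrix.vecMul (Matrix.vecMul (U ω) M) N = U ω := by
      rw [Matrix.vecMul_vecMul,
        Matrix.mul_nonsing_inv M ((Matrix.isUnit_iff_isUnit_det M).mp hM.1), Matrix.vecMul_one]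
    exact (congrFun this i).symm
  refine ⟨j, l, s, -(N j l / N j s), hls, neg_ne_zero.mpr (div_ne_zero hl hs), ?_⟩
  have hUl := fun ω => (hU' ω l).trans (sum_eq_sum_lt_add j _ (fun t => N t l) hl')
  have hUs := fun ω => (hU' ω s).trans (sum_eq_sum_lt_add j _ (fun t => N t s) hs')
  let lin (i : Fin k) (y : Fin (j : ℕ) → F) : F :=
    ∑ t : Fin (j : ℕ), y t * N (Fin.castLE j.isLt.le t) i
  let Y : Ω → (Fin (j : ℕ) → F) × T := fun ω =>
    ((fun i : Fin (j : ℕ) => Matrix.vecMul (U ω) M (Fin.castLE j.isLt.le i)), W ω)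
  have hYmeas : ∀ b, MeasurableSet (Y ⁻¹' {b}) := fun b => by
    have : Measurable fun v : (Fin k → F) × T =>
        ((fun i : Fin (j : ℕ) => Matrix.vecMul v.1 M (Fin.castLE j.isLt.le i)), v.2) :=
      measurable_of_finite _
    exact this.comp (hU.prodMk hW) (measurableSet_singleton b)
  unfold nCondEntropy
  refine div_le_div_of_nonneg_right ?_
    (Real.logb_nonneg one_lt_two (by exact_mod_cast Fintype.card_pos (α := F)))
  let g : (Fin (j : ℕ) → F) × T → F × T := fun b =>
    (lin l b.1 + -(N j l / N j s) * lin s b.1, b.2)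
  have hpair : (fun ω => (U ω l + -(N j l / N j s) * U ω s, W ω)) = fun ω => g (Y ω) := by
    funext ω
    refine Prod.ext ?_ rfl
    change U ω l + _ * U ω s = _
    rw [hUl, hUs]
    simp only [g, lin, Y]
    field_simp
    ring
  have hle := condEntropy_le_comp μ (X := fun ω => U ω l) hYmeas g
  have heq : condEntropy μ (fun ω => U ω l) Y =
      condEntropy μ (fun ω => Matrix.vecMul (U ω) M j) Y :=
    condEntropy_eq_of_equiv μ hYmeas
      (fun b => (Equiv.mulRight₀ (N j l) hl).trans (Equiv.addLeft (lin l b.1))) hUl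
  rw [hpair]
  exact heq.symm.trans_le hle
end
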